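/- Let M = (S, A, s0, P) be a reward-free MDP with finite state space S satisfying the RESET assumption and let L ≥ 1 be a real number. Let (K*_j)_{j≥1} be the layer sequence K*_1 = {s0}, K*_{j+1} = T_L(K*_j). Then for every j ≥ 1 one has K*_j ⊆ K*_{j+1} and K*_j ⊆ S→_L. -/

import Mathlib

open scoped ENNReal Classical

/-- A reward-free MDP with countable state space `S`, action space `A` containing a
distinguished `RESET` action, initial state `s0`, and transition kernel `P`,
satisfying the RESET assumption. -/
structure RFMDP (S : Type) (A : Type) where
  s0 : S
  reset : A
  P : S → A → PMF S
  reset_eq : ∀ s : S, P s reset s0 = 1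

namespace RFMDP

variable {S A : Type}

/-- `survive M π g n s` is the probability that the Markov chain started at `s` and
following policy `π` has not yet hit the goal `g` within the first `n+1` visited states,
i.e. `P(T > n)` where `T = inf {i ≥ 0 : s_{i+1} = g}` and `s_1 = s`. -/
noncomputable def survive (M : RFMDP S A) (π : S → A) (g : S) : ℕ → S → ℝ≥0∞
  | 0, s => if s = g then 0 else 1
  | n + 1, s => if s = g then 0 else ∑' s' : S, M.P s (π s) s' * survive M π g n s'

/-- The value `V^π_g(s)`: the expected hitting time of the goal `g` starting from `s`
and following policy `π` (`+∞` if `g` is almost surely unreachable), computed as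
`E[T] = Σ_{n ≥ 0} P(T > n)`. -/
noncomputable def V (M : RFMDP S A) (π : S → A) (g s : S) : ℝ≥0∞ :=
  ∑' n : ℕ, M.survive π g n s

/-- The set `Π(X)` of policies restricted on `X`: those playing `RESET` outside `X`. -/
def restrictedPolicies (M : RFMDP S A) (X : Set S) : Set (S → A) :=
  {π | ∀ s ∉ X, π s = M.reset}

/-- `V*_{X,g}(s)`: the optimal hitting time of `g` from `s` over policies restricted on `X`. -/
noncomputable def Vstar (M : RFMDP S A) (X : Set S) (g s : S) : ℝ≥0∞ :=
  ⨅ π ∈ M.restrictedPolicies X, M.V π g s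

/-- The state-expansion operator `T_L`. -/
def TL (M : RFMDP S A) (L : ℝ) (X : Set S) : Set S :=
  {s | M.Vstar X s M.s0 ≤ ENNReal.ofReal L}

/-- `S_L^≺`: the least subset of `S` containing `s0` and closed under adding any state `s`
reachable in at most `L` expected steps from `s0` by a policy restricted on
`{s' ∈ S_L^≺ : s' ≺ s}`. -/
def SLprec (M : RFMDP S A) (L : ℝ) (prec : S → S → Prop) : Set S :=
  sInf {X : Set S | M.s0 ∈ X ∧
    ∀ s : S, (∃ π ∈ M.restrictedPolicies {s' ∈ X | prec s' s},
      M.V π s M.s0 ≤ ENNReal.ofReal L) → s ∈ X}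

/-- The set `S→_L` of incrementally `L`-controllable states: the union of `S_L^≺` over
all (strict) partial orders `≺` on `S`. -/
def SLarrow (M : RFMDP S A) (L : ℝ) : Set S :=
  ⋃ (prec : S → S → Prop) (_ : IsStrictOrder S prec), M.SLprec L prec

/-- The layer sequence: `layer 0 = {s0} = K*_1` and `layer (n+1) = T_L (layer n) = K*_{n+2}`. -/
noncomputable def layer (M : RFMDP S A) (L : ℝ) : ℕ → Set S
  | 0 => {M.s0}
  | n + 1 => M.TL L (M.layer L n)

end RFMDP

namespace RFMDP

variable {S A : Type}

lemma restrictedPolicies_mono (M : RFMDP S A) {X Y : Set S} (h : X ⊆ Y) :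
    M.restrictedPolicies X ⊆ M.restrictedPolicies Y :=
  fun _ hπ s hs => hπ s fun hX => hs (h hX)

lemma restrictedPolicies_nonempty (M : RFMDP S A) (X : Set S) :
    (M.restrictedPolicies X).Nonempty :=
  ⟨fun _ => M.reset, fun _ _ => rfl⟩

lemma V_self (M : RFMDP S A) (π : S → A) (g : S) : M.V π g g = 0 := by
  rw [V, ENNReal.tsum_eq_zero]
  rintro (_ | n) <;> simp [survive]

lemma Vstar_self (M : RFMDP S A) (X : Set S) (g : S) : M.Vstar X g g = 0 := by
  obtain ⟨π, hπ⟩ := M.restrictedPolicies_nonempty X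
  exact le_antisymm ((iInf₂_le π hπ).trans (M.V_self π g).le) zero_le

lemma exists_V_eq_Vstar [Finite S] [Finite A] (M : RFMDP S A) (X : Set S) (g s : S) :
    ∃ π ∈ M.restrictedPolicies X, M.V π g s = M.Vstar X g s := by
  have h := ((M.restrictedPolicies_nonempty X).image fun π => M.V π g s).csInf_mem
    (Set.toFinite _)
  rwa [sInf_image] at h

lemma TL_mono (M : RFMDP S A) (L : ℝ) {X Y : Set S} (h : X ⊆ Y) : M.TL L X ⊆ M.TL L Y :=
  fun s hs => show M.Vstar Y s M.s0 ≤ _ from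
    (biInf_mono fun _ hπ => M.restrictedPolicies_mono h hπ).trans hs

lemma layer_subset_succ (M : RFMDP S A) (L : ℝ) (j : ℕ) : M.layer L j ⊆ M.layer L (j + 1) := by
  induction j with
  | zero =>
    rintro _ rfl
    exact (M.Vstar_self _ _).trans_le zero_le
  | succ j ih => exact M.TL_mono L ih

lemma layer_monotone (M : RFMDP S A) (L : ℝ) : Monotone (M.layer L) :=
  monotone_nat_of_le_succ (M.layer_subset_succ L)

/-- `s` precedes `t` when some layer contains `s` but not `t`, that is, when `s` enters the
layer sequence strictly before `t`. -/
def layerPrec (M : RFMDP S A) (L : ℝ) (s t : S) : Prop :=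
  ∃ i, s ∈ M.layer L i ∧ t ∉ M.layer L i

lemma layerPrec_isStrictOrder (M : RFMDP S A) (L : ℝ) : IsStrictOrder S (M.layerPrec L) where
  irrefl _ := fun ⟨_, h, h'⟩ => h' h
  trans := by
    rintro a b c ⟨i, ha, hb⟩ ⟨k, hb', hc⟩
    have hik : i ≤ k := by
      by_contra! h
      exact hb (M.layer_monotone L h.le hb')
    exact ⟨k, M.layer_monotone L hik ha, hc⟩

lemma layer_subset_SLprec [Finite S] [Finite A] (M : RFMDP S A) (L : ℝ) (j : ℕ) :
    M.layer L j ⊆ M.SLprec L (M.layerPrec L) := by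
  refine le_sInf ?_
  rintro X ⟨h0, hX⟩
  induction j with
  | zero =>
    rintro _ rfl
    exact h0
  | succ j ih =>
    intro s hs
    by_cases hj : s ∈ M.layer L j
    · exact ih hj
    obtain ⟨π, hπ, hV⟩ := M.exists_V_eq_Vstar (M.layer L j) s M.s0
    have hsub : M.layer L j ⊆ {t ∈ X | M.layerPrec L t s} := fun t ht => ⟨ih ht, j, ht, hj⟩
    exact hX s ⟨π, M.restrictedPolicies_mono hsub hπ, hV.trans_le hs⟩

end RFMDP

/-- the layer sequence `K*_1 = {s0}`, `K*_{j+1} = T_L(K*_j)` is monotone and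
each layer is contained in `S→_L`.  Here `layer j = K*_{j+1}`, so this covers all `j ≥ 1`. -/
theorem layer_mono_and_subset_SLarrow
    {S A : Type} [Finite S] [Finite A] (M : RFMDP S A) (L : ℝ) (hL : 1 ≤ L) (j : ℕ) :
    M.layer L j ⊆ M.layer L (j + 1) ∧ M.layer L j ⊆ M.SLarrow L :=
  ⟨M.layer_subset_succ L j, fun _ hs =>
    Set.mem_iUnion₂.2 ⟨_, M.layerPrec_isStrictOrder L, M.layer_subset_SLprec L j hs⟩⟩
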